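/- Let 𝔣 > 0 with 18·e·𝔣 < 1 (e = exp(1)), and let δ* be as in the context. Then lim_{β→+∞} Σ̃^𝔣(β) = 18·(e·𝔣)²/(1 − 18·e·𝔣); in particular there exists β₀ such that 1 − 2·M^𝔣(β) > 0 for all β ≥ β₀, so Σ^𝔣(β) and Σ̃^𝔣(β) are eventually well defined and positive. -/

import Mathlib

/-- The minimal constant `M^𝔣(β) = 11/δ*(β) + 9·exp((β−δ*(β))·𝔣)/(β−δ*(β))`. -/
noncomputable def Mconst (𝔣 : ℝ) (δstar : ℝ → ℝ) (β : ℝ) : ℝ :=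
  11 / δstar β + 9 * Real.exp ((β - δstar β) * 𝔣) / (β - δstar β)

/-- The constant `Σ^𝔣(β) = 2·M^𝔣(β)/(1 − 2·M^𝔣(β))` of (1.12). -/
noncomputable def SigmaConst (𝔣 : ℝ) (δstar : ℝ → ℝ) (β : ℝ) : ℝ :=
  2 * Mconst 𝔣 δstar β / (1 - 2 * Mconst 𝔣 δstar β)

/-- The constant `Σ̃^𝔣(β) = Σ^𝔣(β)·exp((β−δ*(β))·𝔣)/(β−δ*(β))` of (1.12). -/
noncomputable def SigmaTilde (𝔣 : ℝ) (δstar : ℝ → ℝ) (β : ℝ) : ℝ :=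
  SigmaConst 𝔣 δstar β * Real.exp ((β - δstar β) * 𝔣) / (β - δstar β)

/-- A solution `x ∈ (0, β)` of the first-order condition satisfies `𝔣 * (β - x) < 1`. -/
theorem mul_sub_lt_one_of_firstOrder {𝔣 β x : ℝ} (hx : x ∈ Set.Ioo 0 β)
    (h : 11 * (β - x) ^ 2 = 9 * Real.exp ((β - x) * 𝔣) * x ^ 2 * (1 - 𝔣 * (β - x))) :
    𝔣 * (β - x) < 1 := by
  have hx0 : 0 < x := hx.1
  have hu : 0 < β - x := sub_pos.2 hx.2
  have hpos : 0 < 9 * Real.exp ((β - x) * 𝔣) * x ^ 2 * (1 - 𝔣 * (β - x)) := by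
    rw [← h]; positivity
  exact sub_pos.1 (pos_of_mul_pos_right hpos (by positivity))

/-- A solution `x ∈ (0, β)` of the first-order condition satisfies
`1 - 𝔣 * (β - x) = O(x⁻²)`, with an explicit constant. -/
theorem one_sub_le_of_firstOrder {𝔣 β x : ℝ} (h𝔣 : 0 < 𝔣) (hx : x ∈ Set.Ioo 0 β)
    (h : 11 * (β - x) ^ 2 = 9 * Real.exp ((β - x) * 𝔣) * x ^ 2 * (1 - 𝔣 * (β - x))) :
    1 - 𝔣 * (β - x) ≤ 11 / (9 * 𝔣 ^ 2) / x ^ 2 := by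
  have hx0 : 0 < x := hx.1
  have hu : 0 < β - x := sub_pos.2 hx.2
  have hlt := mul_sub_lt_one_of_firstOrder hx h
  have hexp : 1 ≤ Real.exp ((β - x) * 𝔣) := Real.one_le_exp (by positivity)
  have hle : 9 * x ^ 2 * (1 - 𝔣 * (β - x)) ≤ 11 * (β - x) ^ 2 := by
    have h0 : 0 ≤ 9 * x ^ 2 * (1 - 𝔣 * (β - x)) :=
      mul_nonneg (by positivity) (sub_pos.2 hlt).le
    calc 9 * x ^ 2 * (1 - 𝔣 * (β - x))
        ≤ Real.exp ((β - x) * 𝔣) * (9 * x ^ 2 * (1 - 𝔣 * (β - x))) :=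
          le_mul_of_one_le_left h0 hexp
      _ = 11 * (β - x) ^ 2 := by rw [h]; ring
  have hsq : (𝔣 * (β - x)) ^ 2 ≤ 1 := pow_le_one₀ (by positivity) hlt.le
  rw [div_div, le_div_iff₀ (by positivity)]
  calc (1 - 𝔣 * (β - x)) * (9 * 𝔣 ^ 2 * x ^ 2)
      = 𝔣 ^ 2 * (9 * x ^ 2 * (1 - 𝔣 * (β - x))) := by ring
    _ ≤ 𝔣 ^ 2 * (11 * (β - x) ^ 2) := by gcongr
    _ = 11 * (𝔣 * (β - x)) ^ 2 := by ring
    _ ≤ 11 := by linarith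

/-- Remark 2.6, asymptotics of `Σ̃^𝔣`. If `18·e·𝔣 < 1` then
`Σ̃^𝔣(β) → 18·(e·𝔣)²/(1 − 18·e·𝔣)` as `β → +∞`, and `1 − 2·M^𝔣(β) > 0` for all
large `β` (so `Σ^𝔣` and `Σ̃^𝔣` are eventually well defined and positive). -/
theorem bsvie_SigmaTilde_asymptotics (𝔣 : ℝ) (h𝔣 : 0 < 𝔣)
    (h18 : 18 * Real.exp 1 * 𝔣 < 1) (δstar : ℝ → ℝ)
    (hδstar : ∀ β : ℝ, 0 < β → δstar β ∈ Set.Ioo 0 β ∧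
      11 * (β - δstar β) ^ 2 =
        9 * Real.exp ((β - δstar β) * 𝔣) * (δstar β) ^ 2 * (1 - 𝔣 * (β - δstar β))) :
    Filter.Tendsto (SigmaTilde 𝔣 δstar) Filter.atTop
      (nhds (18 * (Real.exp 1 * 𝔣) ^ 2 / (1 - 18 * Real.exp 1 * 𝔣))) ∧
    ∃ β₀ : ℝ, ∀ β ≥ β₀, 0 < 1 - 2 * Mconst 𝔣 δstar β := by
  have hδ : Filter.Tendsto δstar Filter.atTop Filter.atTop := by
    refine Filter.tendsto_atTop_mono' _ ?_
      (Filter.tendsto_atTop_add_const_right _ (-(1 / 𝔣)) Filter.tendsto_id)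
    filter_upwards [Filter.eventually_gt_atTop 0] with β hβ
    have hlt := mul_sub_lt_one_of_firstOrder (hδstar β hβ).1 (hδstar β hβ).2
    have hu : β - δstar β < 1 / 𝔣 := by rwa [lt_div_iff₀' h𝔣]
    simp only [id]
    linarith
  have hgap : Filter.Tendsto (fun β => 1 - 𝔣 * (β - δstar β)) Filter.atTop (nhds 0) := by
    refine squeeze_zero' ?_ ?_
      (((Filter.tendsto_pow_atTop two_ne_zero).comp hδ).const_div_atTop (11 / (9 * 𝔣 ^ 2)))
    · filter_upwards [Filter.eventually_gt_atTop 0] with β hβ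
      exact (sub_pos.2 (mul_sub_lt_one_of_firstOrder (hδstar β hβ).1 (hδstar β hβ).2)).le
    · filter_upwards [Filter.eventually_gt_atTop 0] with β hβ
      exact one_sub_le_of_firstOrder h𝔣 (hδstar β hβ).1 (hδstar β hβ).2
  have hmul : Filter.Tendsto (fun β => (β - δstar β) * 𝔣) Filter.atTop (nhds 1) := by
    convert hgap.const_sub 1 using 2 <;> ring
  have hsub : Filter.Tendsto (fun β => β - δstar β) Filter.atTop (nhds (1 / 𝔣)) := by
    refine (hmul.div_const 𝔣).congr fun β => ?_
    field_simp
  have hexp : Filter.Tendsto (fun β => Real.exp ((β - δstar β) * 𝔣)) Filter.atTop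
      (nhds (Real.exp 1)) := (Real.continuous_exp.tendsto 1).comp hmul
  have hinv : 1 / 𝔣 ≠ 0 := one_div_ne_zero h𝔣.ne'
  have hM : Filter.Tendsto (Mconst 𝔣 δstar) Filter.atTop (nhds (9 * Real.exp 1 * 𝔣)) := by
    have h := (hδ.const_div_atTop 11).add ((hexp.const_mul 9).div hsub hinv)
    rwa [zero_add, div_div_eq_mul_div, div_one] at h
  have hden : Filter.Tendsto (fun β => 1 - 2 * Mconst 𝔣 δstar β) Filter.atTop
      (nhds (1 - 18 * Real.exp 1 * 𝔣)) := by
    convert (hM.const_mul 2).const_sub 1 using 2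
    ring
  have hpos : 0 < 1 - 18 * Real.exp 1 * 𝔣 := sub_pos.2 h18
  refine ⟨?_, Filter.eventually_atTop.1 (hden.eventually_const_lt hpos)⟩
  have hval : 18 * (Real.exp 1 * 𝔣) ^ 2 / (1 - 18 * Real.exp 1 * 𝔣) =
      2 * (9 * Real.exp 1 * 𝔣) / (1 - 18 * Real.exp 1 * 𝔣) * Real.exp 1 / (1 / 𝔣) := by
    rw [div_div_eq_mul_div, div_one]
    ring
  rw [hval]
  exact (((hM.const_mul 2).div hden hpos.ne').mul hexp).div hsub hinv
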